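/- One has the identity ⟨du_5, du_6⟩* = (720/7) u_9 - 360 u_5 u_2^2 as polynomials in the six variables y. -/

import Mathlib

open MvPolynomial

noncomputable section

/-- `S6 = x₁ + ⋯ + x₆` inside the eight variables `x₁,…,x₈`. -/
def S6 : MvPolynomial (Fin 8) ℚ := X 0 + X 1 + X 2 + X 3 + X 4 + X 5

/-- The `E₆`-invariant polynomial `U_m`. -/
def U (m : ℕ) : MvPolynomial (Fin 8) ℚ :=
  (∑ i ∈ Finset.univ.filter (fun i : Fin 8 => i.val < 6),
      ((C (1/2 : ℚ) * (X 6 - X 7) - X i + C (1/6 : ℚ) * S6) ^ m +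
        (-(C (1/2 : ℚ) * (X 6 - X 7)) - X i + C (1/6 : ℚ) * S6) ^ m)) +
    ∑ p ∈ Finset.univ.filter (fun p : Fin 8 × Fin 8 => p.1.val < p.2.val ∧ p.2.val < 6),
      (X p.1 + X p.2 - C (1/3 : ℚ) * S6) ^ m

/-- Restriction to the subspace `S6 = 0`, `x₇ + x₈ = 0`:
substitute `x₆ = -(x₁+⋯+x₅)` and `x₈ = -x₇`, with the remaining
variables `y = (x₁,…,x₅,x₇)`. -/
def subE6 : Fin 8 → MvPolynomial (Fin 6) ℚ :=
  ![X 0, X 1, X 2, X 3, X 4, -(X 0 + X 1 + X 2 + X 3 + X 4), X 5, -X 5]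

/-- The basic invariants `u_m` in the six variables `y`, with `u₂ = U₂/12`. -/
def u (m : ℕ) : MvPolynomial (Fin 6) ℚ :=
  if m = 2 then C (1/12 : ℚ) * aeval subE6 (U 2) else aeval subE6 (U m)

/-- The symmetric matrix `G` determined by `u₂(y) = ∑ᵢⱼ Gᵢⱼ yᵢ yⱼ`. -/
def GE6 : Matrix (Fin 6) (Fin 6) ℚ := fun i j =>
  if i = j then coeff (Finsupp.single i 2) (u 2)
  else (1/2) * coeff (Finsupp.single i 1 + Finsupp.single j 1) (u 2)

/-- The pairing `⟨dp, dq⟩* = ∑ᵢⱼ (∂p/∂yᵢ) (G⁻¹)ᵢⱼ (∂q/∂yⱼ)`. -/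
def pairE6 (p q : MvPolynomial (Fin 6) ℚ) : MvPolynomial (Fin 6) ℚ :=
  ∑ i : Fin 6, ∑ j : Fin 6, C (GE6⁻¹ i j) * pderiv i p * pderiv j q

/-- Newton's identities for six numbers with vanishing sum. -/
theorem newton_six (a b c d e f : ℚ) (h : f = -(a + b + c + d + e)) :
    ∃ e2 e3 e4 e5 e6 : ℚ,
      a^2+b^2+c^2+d^2+e^2+f^2 = -2*e2 ∧
      a^3+b^3+c^3+d^3+e^3+f^3 = 3*e3 ∧
      a^4+b^4+c^4+d^4+e^4+f^4 = 2*e2^2 - 4*e4 ∧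
      a^5+b^5+c^5+d^5+e^5+f^5 = -5*e2*e3 + 5*e5 ∧
      ∀ k : ℕ, a^(k+6)+b^(k+6)+c^(k+6)+d^(k+6)+e^(k+6)+f^(k+6) =
        -e2*(a^(k+4)+b^(k+4)+c^(k+4)+d^(k+4)+e^(k+4)+f^(k+4))
        +e3*(a^(k+3)+b^(k+3)+c^(k+3)+d^(k+3)+e^(k+3)+f^(k+3))
        -e4*(a^(k+2)+b^(k+2)+c^(k+2)+d^(k+2)+e^(k+2)+f^(k+2))
        +e5*(a^(k+1)+b^(k+1)+c^(k+1)+d^(k+1)+e^(k+1)+f^(k+1))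
        -e6*(a^k+b^k+c^k+d^k+e^k+f^k) := by
  have h1 : a + b + c + d + e + f = 0 := by rw [h]; ring
  obtain ⟨s2, s3, s4, s5, s6, p2, p3, p4, p5, hr⟩ : ∃ s2 s3 s4 s5 s6 : ℚ,
      a^2+b^2+c^2+d^2+e^2+f^2 = -2*s2 ∧
      a^3+b^3+c^3+d^3+e^3+f^3 = 3*s3 ∧
      a^4+b^4+c^4+d^4+e^4+f^4 = 2*s2^2 - 4*s4 ∧
      a^5+b^5+c^5+d^5+e^5+f^5 = -5*s2*s3 + 5*s5 ∧
      ∀ x : ℚ, (x-a)*(x-b)*(x-c)*(x-d)*(x-e)*(x-f) =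
        x^6 + s2*x^4 - s3*x^3 + s4*x^2 - s5*x + s6 := by
    -- elementary symmetric functions of `a,…,e`, then multiply by `x - f`
    refine ⟨(a*b+a*c+a*d+a*e+b*c+b*d+b*e+c*d+c*e+d*e) + f*(a+b+c+d+e),
      (a*b*c+a*b*d+a*b*e+a*c*d+a*c*e+a*d*e+b*c*d+b*c*e+b*d*e+c*d*e)
        + f*(a*b+a*c+a*d+a*e+b*c+b*d+b*e+c*d+c*e+d*e),
      (a*b*c*d+a*b*c*e+a*b*d*e+a*c*d*e+b*c*d*e)
        + f*(a*b*c+a*b*d+a*b*e+a*c*d+a*c*e+a*d*e+b*c*d+b*c*e+b*d*e+c*d*e),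
      a*b*c*d*e + f*(a*b*c*d+a*b*c*e+a*b*d*e+a*c*d*e+b*c*d*e),
      a*b*c*d*e*f, ?_, ?_, ?_, ?_, ?_⟩
    · rw [h]; ring
    · rw [h]; ring
    · rw [h]; ring
    · rw [h]; ring
    · intro x
      linear_combination (-x^5) * h1
  refine ⟨s2, s3, s4, s5, s6, p2, p3, p4, p5, fun k => ?_⟩
  have ha := hr a
  have hb := hr b
  have hc := hr c
  have hd := hr d
  have he := hr e
  have hf := hr f
  simp only [sub_self, mul_zero, zero_mul] at ha hb hc hd he hf
  linear_combination (-a^k)*ha - b^k*hb - c^k*hc - d^k*hd - e^k*he - f^k*hf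

/-- The identity, evaluated, in six numbers with vanishing sum. -/
theorem key_identity (a b c d e f t : ℚ) (h : f = -(a + b + c + d + e))
    (U9 U5 U2 A5 A6 : ℚ) (F5 F6 : ℚ → ℚ)
    (hU9 : U9 = (t-a)^9+(t-b)^9+(t-c)^9+(t-d)^9+(t-e)^9+(t-f)^9
      +(-t-a)^9+(-t-b)^9+(-t-c)^9+(-t-d)^9+(-t-e)^9+(-t-f)^9
      +(a+b)^9+(a+c)^9+(a+d)^9+(a+e)^9+(a+f)^9+(b+c)^9+(b+d)^9+(b+e)^9+(b+f)^9
      +(c+d)^9+(c+e)^9+(c+f)^9+(d+e)^9+(d+f)^9+(e+f)^9)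
    (hU5 : U5 = (t-a)^5+(t-b)^5+(t-c)^5+(t-d)^5+(t-e)^5+(t-f)^5
      +(-t-a)^5+(-t-b)^5+(-t-c)^5+(-t-d)^5+(-t-e)^5+(-t-f)^5
      +(a+b)^5+(a+c)^5+(a+d)^5+(a+e)^5+(a+f)^5+(b+c)^5+(b+d)^5+(b+e)^5+(b+f)^5
      +(c+d)^5+(c+e)^5+(c+f)^5+(d+e)^5+(d+f)^5+(e+f)^5)
    (hU2 : U2 = t^2 + (a^2+b^2+c^2+d^2+e^2+f^2)/2)
    (hA5 : A5 = 5*((t-a)^4+(t-b)^4+(t-c)^4+(t-d)^4+(t-e)^4+(t-f)^4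
      -((-t-a)^4+(-t-b)^4+(-t-c)^4+(-t-d)^4+(-t-e)^4+(-t-f)^4)))
    (hA6 : A6 = 6*((t-a)^5+(t-b)^5+(t-c)^5+(t-d)^5+(t-e)^5+(t-f)^5
      -((-t-a)^5+(-t-b)^5+(-t-c)^5+(-t-d)^5+(-t-e)^5+(-t-f)^5)))
    (hF5 : ∀ x, F5 x = 5*(-(t-x)^4-(-t-x)^4-(2*x)^4
      +(x+a)^4+(x+b)^4+(x+c)^4+(x+d)^4+(x+e)^4+(x+f)^4))
    (hF6 : ∀ x, F6 x = 6*(-(t-x)^5-(-t-x)^5-(2*x)^5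
      +(x+a)^5+(x+b)^5+(x+c)^5+(x+d)^5+(x+e)^5+(x+f)^5)) :
    A5*A6 + 2*(F5 a*F6 a+F5 b*F6 b+F5 c*F6 c+F5 d*F6 d+F5 e*F6 e+F5 f*F6 f
      - (F5 a+F5 b+F5 c+F5 d+F5 e+F5 f)*(F6 a+F6 b+F6 c+F6 d+F6 e+F6 f)/6)
    = 720/7*U9 - 360*U5*U2^2 := by
  obtain ⟨e2, e3, e4, e5, e6, n2, n3, n4, n5, hn⟩ := newton_six a b c d e f h
  have n6 := hn 0
  have n7 := hn 1
  have n8 := hn 2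
  have n9 := hn 3
  have n1 : a + b + c + d + e + f = 0 := by rw [h]; ring
  clear hn h
  norm_num only [pow_zero, pow_one] at n6 n7 n8 n9
  obtain ⟨p1, h1⟩ : ∃ p, p = a + b + c + d + e + f := ⟨_, rfl⟩
  obtain ⟨p2, h2⟩ : ∃ p, p = a^2+b^2+c^2+d^2+e^2+f^2 := ⟨_, rfl⟩
  obtain ⟨p3, h3⟩ : ∃ p, p = a^3+b^3+c^3+d^3+e^3+f^3 := ⟨_, rfl⟩
  obtain ⟨p4, h4⟩ : ∃ p, p = a^4+b^4+c^4+d^4+e^4+f^4 := ⟨_, rfl⟩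
  obtain ⟨p5, h5⟩ : ∃ p, p = a^5+b^5+c^5+d^5+e^5+f^5 := ⟨_, rfl⟩
  obtain ⟨p6, h6⟩ : ∃ p, p = a^6+b^6+c^6+d^6+e^6+f^6 := ⟨_, rfl⟩
  obtain ⟨p7, h7⟩ : ∃ p, p = a^7+b^7+c^7+d^7+e^7+f^7 := ⟨_, rfl⟩
  obtain ⟨p8, h8⟩ : ∃ p, p = a^8+b^8+c^8+d^8+e^8+f^8 := ⟨_, rfl⟩
  obtain ⟨p9, h9⟩ : ∃ p, p = a^9+b^9+c^9+d^9+e^9+f^9 := ⟨_, rfl⟩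
  have gU9 : U9 = -2*(p9+36*t^2*p7+126*t^4*p5+84*t^6*p3+9*t^8*p1)
      + (6*p9+9*p1*p8+36*p2*p7+84*p3*p6+126*p4*p5-256*p9) := by
    rw [hU9, h1, h2, h3, h4, h5, h6, h7, h8, h9]; ring
  have gU5 : U5 = -2*(p5+10*t^2*p3+5*t^4*p1)
      + (6*p5+5*p1*p4+10*p2*p3-16*p5) := by
    rw [hU5, h1, h2, h3, h4, h5]; ring
  have gU2 : U2 = t^2 + p2/2 := by rw [hU2, h2]
  have gA5 : A5 = -40*(t^3*p1+t*p3) := by rw [hA5, h1, h3]; ring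
  have gA6 : A6 = 12*(6*t^5+10*t^3*p2+5*t*p4) := by rw [hA6, h2, h4]; ring
  have gF5 : ∀ x, F5 x = (-60)*x^4 + 20*p1*x^3+(30*p2-60*t^2)*x^2+20*p3*x+(5*p4-10*t^4) := by
    intro x; rw [hF5, h1, h2, h3, h4]; ring
  have gF6 : ∀ x, F6 x = (-144)*x^5 + 30*p1*x^4+(60*p2+120*t^2)*x^3+60*p3*x^2
      +(30*p4+60*t^4)*x+6*p5 := by
    intro x; rw [hF6, h1, h2, h3, h4, h5]; ring
  clear hU9 hU5 hU2 hA5 hA6 hF5 hF6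
  rw [← h1] at n1
  rw [← h2] at n2
  rw [← h3] at n3
  rw [← h4] at n4
  rw [← h5] at n5
  rw [← h6, ← h4, ← h3, ← h2, ← h1] at n6
  rw [← h7, ← h5, ← h4, ← h3, ← h2, ← h1] at n7
  rw [← h8, ← h6, ← h5, ← h4, ← h3, ← h2] at n8
  rw [← h9, ← h7, ← h6, ← h5, ← h4, ← h3] at n9
  have hprod : ∀ c4 c2 c1 c0 d5 d3 d2 d1 d0 : ℚ,
      (∀ x, F5 x = c4*x^4+c2*x^2+c1*x+c0) →
      (∀ x, F6 x = d5*x^5+d3*x^3+d2*x^2+d1*x+d0) →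
      F5 a*F6 a+F5 b*F6 b+F5 c*F6 c+F5 d*F6 d+F5 e*F6 e+F5 f*F6 f =
       c4*d5*p9+c4*d3*p7+c4*d2*p6+c4*d1*p5+c4*d0*p4
       +c2*d5*p7+c2*d3*p5+c2*d2*p4+c2*d1*p3+c2*d0*p2
       +c1*d5*p6+c1*d3*p4+c1*d2*p3+c1*d1*p2+c1*d0*p1
       +c0*d5*p5+c0*d3*p3+c0*d2*p2+c0*d1*p1+6*c0*d0 ∧
      F5 a+F5 b+F5 c+F5 d+F5 e+F5 f = c4*p4+c2*p2+c1*p1+6*c0 ∧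
      F6 a+F6 b+F6 c+F6 d+F6 e+F6 f = d5*p5+d3*p3+d2*p2+d1*p1+6*d0 := by
    intro c4 c2 c1 c0 d5 d3 d2 d1 d0 hc hd
    simp only [hc, hd]
    rw [h1, h2, h3, h4, h5, h6, h7, h9]
    refine ⟨?_, ?_, ?_⟩ <;> ring
  obtain ⟨q1, q2, q3⟩ := hprod (-60) (30*p2-60*t^2) (20*p3) (5*p4-10*t^4)
    (-144) (60*p2+120*t^2) (60*p3) (30*p4+60*t^4) (6*p5)
    (fun x => by rw [gF5, n1]; ring) (fun x => by rw [gF6, n1]; ring)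
  rw [q1, q2, q3, gU9, gU5, gU2, gA5, gA6]
  clear q1 q2 q3 gU9 gU5 gU2 gA5 gA6 hprod gF5 gF6 h1 h2 h3 h4 h5 h6 h7 h8 h9
  rw [n9, n7, n6, n5, n4, n3, n2, n1]
  ring

theorem aeval_S6 : aeval subE6 S6 = 0 := by
  simp [S6, subE6]

theorem aeval_U (m : ℕ) : aeval subE6 (U m) =
    (X 5 - X 0)^m + (X 5 - X 1)^m + (X 5 - X 2)^m + (X 5 - X 3)^m + (X 5 - X 4)^m
    + (X 5 - -(X 0+X 1+X 2+X 3+X 4))^m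
    + (-X 5 - X 0)^m + (-X 5 - X 1)^m + (-X 5 - X 2)^m + (-X 5 - X 3)^m + (-X 5 - X 4)^m
    + (-X 5 - -(X 0+X 1+X 2+X 3+X 4))^m
    + (X 0 + X 1)^m + (X 0 + X 2)^m + (X 0 + X 3)^m + (X 0 + X 4)^m
    + (X 0 + -(X 0+X 1+X 2+X 3+X 4))^m
    + (X 1 + X 2)^m + (X 1 + X 3)^m + (X 1 + X 4)^m + (X 1 + -(X 0+X 1+X 2+X 3+X 4))^m
    + (X 2 + X 3)^m + (X 2 + X 4)^m + (X 2 + -(X 0+X 1+X 2+X 3+X 4))^m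
    + (X 3 + X 4)^m + (X 3 + -(X 0+X 1+X 2+X 3+X 4))^m
    + (X 4 + -(X 0+X 1+X 2+X 3+X 4))^m := by
  have hh : (C (1/2 : ℚ) : MvPolynomial (Fin 6) ℚ) * (X 5 - -X 5) = X 5 := by
    have : (C (1/2 : ℚ) : MvPolynomial (Fin 6) ℚ) * 2 = 1 := by
      rw [show (2 : MvPolynomial (Fin 6) ℚ) = C 2 from rfl, ← C_mul]; norm_num
    linear_combination X 5 * this
  have s0 : subE6 0 = X 0 := rfl
  have s1 : subE6 1 = X 1 := rfl
  have s2 : subE6 2 = X 2 := rfl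
  have s3 : subE6 3 = X 3 := rfl
  have s4 : subE6 4 = X 4 := rfl
  have s5 : subE6 5 = -(X 0+X 1+X 2+X 3+X 4) := rfl
  have s6 : subE6 6 = X 5 := rfl
  have s7 : subE6 7 = -X 5 := rfl
  have hsum1 : ∀ g : Fin 8 → MvPolynomial (Fin 8) ℚ,
      ∑ i ∈ Finset.univ.filter (fun i : Fin 8 => i.val < 6), g i
        = g 0 + g 1 + g 2 + g 3 + g 4 + g 5 := by
    intro g
    rw [Finset.sum_filter, Fin.sum_univ_eight]
    simp
  have hsum2 : ∀ g : Fin 8 × Fin 8 → MvPolynomial (Fin 8) ℚ,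
      ∑ p ∈ Finset.univ.filter (fun p : Fin 8 × Fin 8 => p.1.val < p.2.val ∧ p.2.val < 6), g p
        = g (0,1) + g (0,2) + g (0,3) + g (0,4) + g (0,5) + g (1,2) + g (1,3) + g (1,4) + g (1,5)
          + g (2,3) + g (2,4) + g (2,5) + g (3,4) + g (3,5) + g (4,5) := by
    intro g
    rw [Finset.sum_filter, Fintype.sum_prod_type]
    simp only [Fin.sum_univ_eight]
    simp
    abel
  unfold U
  rw [hsum1, hsum2]
  simp only [map_add, map_sub, map_mul, map_neg, map_pow, aeval_X, aeval_S6, algHom_C,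
    algebraMap_eq, mul_zero, add_zero, sub_zero, s0, s1, s2, s3, s4, s5, s6, s7, hh]
  abel

theorem u_two : u 2 = X 5 * X 5 + X 0 * X 0 + X 1 * X 1 + X 2 * X 2 + X 3 * X 3 + X 4 * X 4
    + X 0 * X 1 + X 0 * X 2 + X 0 * X 3 + X 0 * X 4 + X 1 * X 2 + X 1 * X 3 + X 1 * X 4
    + X 2 * X 3 + X 2 * X 4 + X 3 * X 4 := by
  unfold u
  rw [if_pos rfl, aeval_U]
  have : (C (1/12 : ℚ) : MvPolynomial (Fin 6) ℚ) * 12 = 1 := by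
    rw [show (12 : MvPolynomial (Fin 6) ℚ) = C 12 from rfl, ← C_mul]; norm_num
  linear_combination (X 5 * X 5 + X 0 * X 0 + X 1 * X 1 + X 2 * X 2 + X 3 * X 3 + X 4 * X 4
    + X 0 * X 1 + X 0 * X 2 + X 0 * X 3 + X 0 * X 4 + X 1 * X 2 + X 1 * X 3 + X 1 * X 4
    + X 2 * X 3 + X 2 * X 4 + X 3 * X 4) * this

theorem coeff_XX (i j k l : Fin 6) :
    coeff (Finsupp.single i 1 + Finsupp.single j 1) (X k * X l : MvPolynomial (Fin 6) ℚ) =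
      if (k = i ∧ l = j) ∨ (k = j ∧ l = i) then 1 else 0 := by
  have : (X k * X l : MvPolynomial (Fin 6) ℚ)
      = monomial (Finsupp.single k 1 + Finsupp.single l 1) 1 := by
    simp [X, monomial_mul]
  rw [this, coeff_monomial]
  congr 1
  rw [Finsupp.single_add_single_eq_single_add_single (by norm_num) (by norm_num)]
  simp

theorem GE6_eq : GE6 = !![1,1/2,1/2,1/2,1/2,0; 1/2,1,1/2,1/2,1/2,0; 1/2,1/2,1,1/2,1/2,0;
    1/2,1/2,1/2,1,1/2,0; 1/2,1/2,1/2,1/2,1,0; 0,0,0,0,0,1] := by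
  ext i j
  have h2 : (Finsupp.single i 2 : Fin 6 →₀ ℕ) = Finsupp.single i 1 + Finsupp.single i 1 := by
    rw [← Finsupp.single_add]
  unfold GE6
  rw [h2, u_two]
  simp only [coeff_add, coeff_XX]
  fin_cases i <;> fin_cases j <;> simp

theorem GE6_inv : GE6⁻¹ = !![5/3,-1/3,-1/3,-1/3,-1/3,0; -1/3,5/3,-1/3,-1/3,-1/3,0;
    -1/3,-1/3,5/3,-1/3,-1/3,0; -1/3,-1/3,-1/3,5/3,-1/3,0; -1/3,-1/3,-1/3,-1/3,5/3,0;
    0,0,0,0,0,1] := by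
  apply Matrix.inv_eq_right_inv
  rw [GE6_eq]
  ext i j
  rw [Matrix.mul_apply, Fin.sum_univ_six]
  fin_cases i <;> fin_cases j <;> simp <;> norm_num

theorem eval_pair (p q : MvPolynomial (Fin 6) ℚ) (y : Fin 6 → ℚ) (P Q : Fin 6 → ℚ)
    (hP : ∀ i, eval y (pderiv i p) = P i) (hQ : ∀ i, eval y (pderiv i q) = Q i) :
    eval y (pairE6 p q) = P 5 * Q 5 + 2*(P 0*Q 0+P 1*Q 1+P 2*Q 2+P 3*Q 3+P 4*Q 4
      - (P 0+P 1+P 2+P 3+P 4)*(Q 0+Q 1+Q 2+Q 3+Q 4)/6) := by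
  unfold pairE6
  rw [GE6_inv]
  simp only [Fin.sum_univ_six, map_add, map_mul, eval_C, hP, hQ]
  simp
  ring

theorem eval_pderiv_u (m : ℕ) (hm : m + 1 ≠ 2) (y : Fin 6 → ℚ) (F : ℚ → ℚ) (z : ℚ)
    (hz : z = -(y 0 + y 1 + y 2 + y 3 + y 4))
    (hF : ∀ x, F x = (m+1)*(-(y 5-x)^m-(-y 5-x)^m-(2*x)^m
      +(x+y 0)^m+(x+y 1)^m+(x+y 2)^m+(x+y 3)^m+(x+y 4)^m+(x+z)^m)) (i : Fin 6) :
    eval y (pderiv i (u (m+1))) = (![F (y 0) - F z, F (y 1) - F z, F (y 2) - F z,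
      F (y 3) - F z, F (y 4) - F z,
      (m+1)*((y 5-y 0)^m+(y 5-y 1)^m+(y 5-y 2)^m+(y 5-y 3)^m+(y 5-y 4)^m+(y 5-z)^m
      -((-y 5-y 0)^m+(-y 5-y 1)^m+(-y 5-y 2)^m+(-y 5-y 3)^m+(-y 5-y 4)^m+(-y 5-z)^m))]
        : Fin 6 → ℚ) i := by
  unfold u
  rw [if_neg hm, aeval_U]
  simp only [map_add, map_sub, map_neg, pderiv_pow, map_mul, map_pow, eval_X, pderiv_X,
    Nat.add_sub_cancel, hF, ← hz, map_natCast, eval_neg]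
  fin_cases i <;> simp [Pi.single_apply] <;> ring

/-- `⟨du₅, du₆⟩* = (720/7) u₉ - 360 u₅ u₂²`. -/
theorem E6_pair_u5_u6 :
    pairE6 (u 5) (u 6) = C (720/7 : ℚ) * u 9 - C (360 : ℚ) * u 5 * u 2 ^ 2 := by
  apply MvPolynomial.funext
  intro y
  obtain ⟨z, hz⟩ : ∃ z, z = -(y 0 + y 1 + y 2 + y 3 + y 4) := ⟨_, rfl⟩
  obtain ⟨F5, hF5⟩ : ∃ F : ℚ → ℚ, ∀ x, F x = 5*(-(y 5-x)^4-(-y 5-x)^4-(2*x)^4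
      +(x+y 0)^4+(x+y 1)^4+(x+y 2)^4+(x+y 3)^4+(x+y 4)^4+(x+z)^4) := ⟨_, fun _ => rfl⟩
  obtain ⟨F6, hF6⟩ : ∃ F : ℚ → ℚ, ∀ x, F x = 6*(-(y 5-x)^5-(-y 5-x)^5-(2*x)^5
      +(x+y 0)^5+(x+y 1)^5+(x+y 2)^5+(x+y 3)^5+(x+y 4)^5+(x+z)^5) := ⟨_, fun _ => rfl⟩
  have k := key_identity (y 0) (y 1) (y 2) (y 3) (y 4) z (y 5) hz (eval y (u 9)) (eval y (u 5))
    (eval y (u 2)) _ _ F5 F6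
    (by unfold u; rw [if_neg (by norm_num), aeval_U]
        simp only [map_add, map_sub, map_neg, map_pow, eval_X, ← hz])
    (by unfold u; rw [if_neg (by norm_num), aeval_U]
        simp only [map_add, map_sub, map_neg, map_pow, eval_X, ← hz])
    (by rw [u_two, hz]; simp only [map_add, map_mul, eval_X]; ring) rfl rfl hF5 hF6
  rw [eval_pair _ _ _ _ _
    (eval_pderiv_u 4 (by norm_num) y F5 z hz (fun x => by rw [hF5]; norm_num))
    (eval_pderiv_u 5 (by norm_num) y F6 z hz (fun x => by rw [hF6]; norm_num))]
  simp only [map_sub, map_mul, map_pow, eval_C]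
  rw [← k]
  simp
  ring
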